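/- Let μ be a packed composition of type (k,n) and let ν be a composition such that ν_{i_0} = 0 for some index i_0 ≤ k. Then μ does not precede ν (μ ⋠ ν in the precedence order); consequently E*_μ(ν̃) = 0 and f*_μ(ν̃) = 0. -/

import Mathlib

open MvPolynomial

noncomputable section
open scoped Classical

/-- The field `K = ℚ(q,t)`. -/
abbrev K : Type := FractionRing (MvPolynomial (Fin 2) ℚ)

/-- The indeterminate `q` as an element of `K`. -/
def qq : K := algebraMap (MvPolynomial (Fin 2) ℚ) K (X 0)

/-- The indeterminate `t` as an element of `K`. -/
def tt : K := algebraMap (MvPolynomial (Fin 2) ℚ) K (X 1)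

/-- The size `|ν|` of a composition. -/
def csize {n : ℕ} (ν : Fin n → ℕ) : ℕ := ∑ i, ν i

/-- `k_i(ν) = #{j < i : ν_j > ν_i} + #{j > i : ν_j ≥ ν_i}`. -/
def kstat {n : ℕ} (ν : Fin n → ℕ) (i : Fin n) : ℕ :=
  Set.ncard {j : Fin n | j < i ∧ ν i < ν j} + Set.ncard {j : Fin n | i < j ∧ ν i ≤ ν j}

/-- The evaluation point `ν̃ = (q^{ν_i} t^{-k_i(ν)})_i`. -/
def evalPt {n : ℕ} (ν : Fin n → ℕ) : Fin n → K :=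
  fun i => qq ^ ν i * tt ^ (-(kstat ν i : ℤ))

/-- Weakly decreasing composition. -/
def IsPartition {n : ℕ} (l : Fin n → ℕ) : Prop := ∀ i j : Fin n, i ≤ j → l j ≤ l i

/-- The action `σ·μ := μ ∘ σ⁻¹`. -/
def permAct {n : ℕ} (σ : Equiv.Perm (Fin n)) (μ : Fin n → ℕ) : Fin n → ℕ := μ ∘ ⇑σ.symm

/-- `S_n(λ)`: the rearrangements of `λ`. -/
def Sn {n : ℕ} (l : Fin n → ℕ) : Set (Fin n → ℕ) :=
  {μ | ∃ σ : Equiv.Perm (Fin n), permAct σ l = μ}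

/-- The rearrangements of `λ` as a `Finset`. -/
def SnFinset {n : ℕ} (l : Fin n → ℕ) : Finset (Fin n → ℕ) :=
  Finset.image (fun σ : Equiv.Perm (Fin n) => permAct σ l) Finset.univ

/-- The exponent `Finsupp` of the monomial `x^μ`. -/
def expOf {n : ℕ} (μ : Fin n → ℕ) : Fin n →₀ ℕ := Finsupp.equivFunOnFinite.symm μ

/-- Characterization of the interpolation nonsymmetric Macdonald polynomial `E*_μ`. -/
def IsEstar {n : ℕ} (μ : Fin n → ℕ) (f : MvPolynomial (Fin n) K) : Prop :=
  f.totalDegree ≤ csize μ ∧ coeff (expOf μ) f = 1 ∧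
    ∀ ν : Fin n → ℕ, csize ν ≤ csize μ → ν ≠ μ → eval (evalPt ν) f = 0

/-- The interpolation nonsymmetric Macdonald polynomial `E*_μ` (unique by Knop–Sahi). -/
def Estar {n : ℕ} (μ : Fin n → ℕ) : MvPolynomial (Fin n) K :=
  if h : ∃ f, IsEstar μ f then h.choose else 0

/-- Characterization of the interpolation (symmetric) Macdonald polynomial `P*_λ`. -/
def IsPstar {n : ℕ} (l : Fin n → ℕ) (f : MvPolynomial (Fin n) K) : Prop :=
  f.IsSymmetric ∧ f.totalDegree ≤ csize l ∧ coeff (expOf l) f = 1 ∧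
    ∀ ν : Fin n → ℕ, IsPartition ν → csize ν ≤ csize l → ν ≠ l → eval (evalPt ν) f = 0

/-- The interpolation Macdonald polynomial `P*_λ`. -/
def Pstar {n : ℕ} (l : Fin n → ℕ) : MvPolynomial (Fin n) K :=
  if h : ∃ f, IsPstar l f then h.choose else 0

/-- The space `V*_λ`. -/
def Vstar {n : ℕ} (l : Fin n → ℕ) : Submodule K (MvPolynomial (Fin n) K) :=
  (restrictTotalDegree (Fin n) K (csize l)) ⊓
    ⨅ (ν : Fin n → ℕ) (_ : csize ν ≤ csize l ∧ ν ∉ Sn l),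
      LinearMap.ker (aeval (R := K) (evalPt ν)).toLinearMap

/-- Exchange of the variables `x_i` and `x_j` in a polynomial. -/
def swapVars {n : ℕ} (i j : Fin n) (f : MvPolynomial (Fin n) K) : MvPolynomial (Fin n) K :=
  rename (Equiv.swap i j) f

/-- Exact division of polynomials: the unique `g` with `a = b * g` when it exists. -/
def exactDiv {n : ℕ} (a b : MvPolynomial (Fin n) K) : MvPolynomial (Fin n) K :=
  if h : ∃ g, a = b * g then h.choose else 0

/-- The Hecke operator
`T f = t f − ((t x_i − x_j)/(x_i − x_j))·(f − s_i f)` (where `j = i+1`). -/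
def hecke {n : ℕ} (i j : Fin n) (f : MvPolynomial (Fin n) K) : MvPolynomial (Fin n) K :=
  C tt * f - (C tt * X i - X j) * exactDiv (f - swapVars i j f) (X i - X j)

/-- The Coxeter length of a permutation (number of inversions). -/
def permLength {n : ℕ} (σ : Equiv.Perm (Fin n)) : ℕ :=
  Set.ncard {p : Fin n × Fin n | p.1 < p.2 ∧ σ p.2 < σ p.1}

/-- The adjacent transposition `s_i = (i, i+1)` (0-indexed). -/
def adjSwap {n : ℕ} (i : {i : ℕ // i + 1 < n}) : Equiv.Perm (Fin n) :=
  Equiv.swap ⟨i.1, Nat.lt_of_succ_lt i.2⟩ ⟨i.1 + 1, i.2⟩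

/-- The Hecke operator `T_i` for an adjacent transposition index. -/
def heckeAt {n : ℕ} (i : {i : ℕ // i + 1 < n}) :
    MvPolynomial (Fin n) K → MvPolynomial (Fin n) K :=
  hecke ⟨i.1, Nat.lt_of_succ_lt i.2⟩ ⟨i.1 + 1, i.2⟩

/-- `T_{i_1} ⋯ T_{i_ℓ} f` for a word `w = [i_1, …, i_ℓ]`. -/
def Tword {n : ℕ} (w : List {i : ℕ // i + 1 < n}) (f : MvPolynomial (Fin n) K) :
    MvPolynomial (Fin n) K :=
  w.foldr heckeAt f

/-- `w` is a reduced word for `σ`. -/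
def IsReducedWordOf {n : ℕ} (w : List {i : ℕ // i + 1 < n}) (σ : Equiv.Perm (Fin n)) : Prop :=
  (w.map adjSwap).prod = σ ∧ w.length = permLength σ

/-- `T_σ`, computed from a reduced word of `σ` (independent of the choice, by the
Hecke algebra relations). -/
def Tsigma {n : ℕ} (σ : Equiv.Perm (Fin n)) :
    MvPolynomial (Fin n) K → MvPolynomial (Fin n) K :=
  if h : ∃ w, IsReducedWordOf w σ then Tword h.choose else id

/-- `σ_μ`: the (unique) shortest permutation with `σ·l = μ`. -/
def sigmaMin {n : ℕ} (l μ : Fin n → ℕ) : Equiv.Perm (Fin n) :=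
  if h : ∃ σ, permAct σ l = μ ∧ ∀ τ, permAct τ l = μ → permLength σ ≤ permLength τ then
    h.choose else 1

/-- The weakly decreasing rearrangement of a composition. -/
def sortDesc {n : ℕ} (μ : Fin n → ℕ) : Fin n → ℕ :=
  if h : ∃ l, IsPartition l ∧ μ ∈ Sn l then h.choose else μ

/-- The interpolation ASEP polynomial `f*_μ = T_{σ_μ} E*_λ`, where `λ` is the weakly
decreasing rearrangement of `μ`. -/
def fstar {n : ℕ} (μ : Fin n → ℕ) : MvPolynomial (Fin n) K :=
  Tsigma (sigmaMin (sortDesc μ) μ) (Estar (sortDesc μ))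

/-- The composition with entries `i` and `j` exchanged. -/
def swapEntries {n : ℕ} (i j : Fin n) (μ : Fin n → ℕ) : Fin n → ℕ := μ ∘ ⇑(Equiv.swap i j)
/-- `μ` is packed of type `(k,n)`: nonzero entries exactly in the first `k` positions. -/
def Packed {n : ℕ} (k : ℕ) (μ : Fin n → ℕ) : Prop :=
  ∀ i : Fin n, ((i : ℕ) < k → μ i ≠ 0) ∧ (k ≤ (i : ℕ) → μ i = 0)

/-- The precedence order: `μ ⪯ ν`. -/
def Precedes {n : ℕ} (μ ν : Fin n → ℕ) : Prop :=
  ∃ π : Equiv.Perm (Fin n), (∀ i, μ i ≤ ν (π i)) ∧ ∀ i, π i < i → μ i < ν (π i)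


lemma tt_ne : tt ≠ 0 := by
  unfold tt
  simp [X_ne_zero]

lemma qq_ne : qq ≠ 0 := by
  unfold qq
  simp [X_ne_zero]

lemma qt_ne (a b c : ℕ) : qq ^ (a+1) * tt ^ (-(b:ℤ)) ≠ tt ^ (-(c:ℤ)) := by
  intro h
  have ht := tt_ne
  rw [zpow_neg, zpow_neg, zpow_natCast, zpow_natCast] at h
  field_simp at h
  unfold qq tt at h
  rw [← map_pow, ← map_pow, ← map_pow, ← map_mul] at h
  have h2 := IsFractionRing.injective (MvPolynomial (Fin 2) ℚ) K h
  have h3 := congrArg (eval (fun i : Fin 2 => if i = 0 then (0:ℚ) else 1)) h2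
  simp at h3

lemma kstat_eq {n : ℕ} (ν : Fin n → ℕ) (i : Fin n) :
    kstat ν i = (∑ j, if j < i ∧ ν i < ν j then 1 else 0) +
      ∑ j, if i < j ∧ ν i ≤ ν j then 1 else 0 := by
  unfold kstat
  rw [Set.ncard_eq_toFinset_card', Set.ncard_eq_toFinset_card']
  rw [← Finset.card_filter, ← Finset.card_filter]
  simp

def Phi {n : ℕ} (η : Fin (n+1) → ℕ) : Fin (n+1) → ℕ :=
  Fin.cons (η (Fin.last n) + 1) (fun j => η j.castSucc)

lemma csize_Phi {n : ℕ} (η : Fin (n+1) → ℕ) : csize (Phi η) = csize η + 1 := by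
  unfold csize Phi
  rw [Fin.sum_univ_succ, Fin.sum_univ_castSucc]
  simp
  ring

lemma csize_cons {n : ℕ} (η : Fin n → ℕ) : csize (Fin.cons 0 η : Fin (n+1) → ℕ) = csize η := by
  unfold csize
  rw [Fin.sum_univ_succ]
  simp

lemma kstat_Phi_zero {n : ℕ} (η : Fin (n+1) → ℕ) :
    kstat (Phi η) 0 = kstat η (Fin.last n) := by
  rw [kstat_eq, kstat_eq]
  unfold Phi
  rw [Fin.sum_univ_succ, Fin.sum_univ_succ, Fin.sum_univ_castSucc, Fin.sum_univ_castSucc]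
  simp [Fin.castSucc_lt_last, Fin.not_lt.2 (Fin.le_last _)]

lemma kstat_Phi_succ {n : ℕ} (η : Fin (n+1) → ℕ) (i : Fin n) :
    kstat (Phi η) i.succ = kstat η i.castSucc := by
  rw [kstat_eq, kstat_eq]
  unfold Phi
  rw [Fin.sum_univ_succ, Fin.sum_univ_succ, Fin.sum_univ_castSucc, Fin.sum_univ_castSucc]
  simp [Fin.castSucc_lt_last, Fin.not_lt.2 (Fin.le_last _)]
  ring

lemma kstat_cons_zero {n : ℕ} (ν : Fin n → ℕ) :
    kstat (Fin.cons 0 ν : Fin (n+1) → ℕ) 0 = n := by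
  rw [kstat_eq, Fin.sum_univ_succ, Fin.sum_univ_succ]
  simp

lemma kstat_cons_succ {n : ℕ} (ν : Fin n → ℕ) (i : Fin n) :
    kstat (Fin.cons 0 ν : Fin (n+1) → ℕ) i.succ = kstat ν i := by
  rw [kstat_eq, kstat_eq, Fin.sum_univ_succ, Fin.sum_univ_succ]
  simp

lemma kstat_first {n : ℕ} (ν : Fin (n+1) → ℕ) (i : Fin (n+1)) (h0 : ν i = 0)
    (h : ∀ j < i, ν j ≠ 0) : kstat ν i = n := by
  rw [kstat_eq, ← Finset.sum_add_distrib]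
  have : ∀ j : Fin (n+1), ((if j < i ∧ ν i < ν j then 1 else 0) +
      if i < j ∧ ν i ≤ ν j then 1 else 0) = if j = i then 0 else 1 := by
    intro j
    rcases lt_trichotomy j i with hj | hj | hj
    · have := Nat.pos_of_ne_zero (h j hj)
      simp [hj, hj.ne, h0, this, hj.not_gt]
    · simp [hj]
    · simp [hj, hj.ne', h0, hj.not_gt]
  rw [Finset.sum_congr rfl (fun j _ => this j)]
  rw [Finset.sum_ite, Finset.filter_not, Finset.filter_eq']
  simp [Finset.card_sdiff]

lemma evalPt_cons {n : ℕ} (ν : Fin n → ℕ) :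
    evalPt (Fin.cons 0 ν : Fin (n+1) → ℕ) = Fin.cons (tt ^ (-(n:ℤ))) (evalPt ν) := by
  funext i
  refine Fin.cases ?_ (fun i => ?_) i
  · simp [evalPt, kstat_cons_zero]
  · simp [evalPt, kstat_cons_succ]

lemma evalPt_Phi {n : ℕ} (η : Fin (n+1) → ℕ) :
    evalPt (Phi η) = Fin.cons (qq * evalPt η (Fin.last n)) (fun j => evalPt η j.castSucc) := by
  funext i
  refine Fin.cases ?_ (fun i => ?_) i
  · simp only [evalPt, kstat_Phi_zero]
    simp only [Phi, Fin.cons_zero]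
    ring
  · simp only [evalPt, kstat_Phi_succ]
    simp only [Phi, Fin.cons_succ]

/-- substitution by polynomials of degree at most one does not raise the degree -/
lemma totalDegree_aeval_le' {m n : ℕ} (g : Fin m → MvPolynomial (Fin n) K)
    (hg : ∀ i, (g i).totalDegree ≤ 1) (f : MvPolynomial (Fin m) K) :
    (aeval g f).totalDegree ≤ f.totalDegree := by
  rw [aeval_def, eval₂_eq]
  refine totalDegree_finsetSum_le (fun d hd => ?_)
  refine (totalDegree_mul _ _).trans ?_
  rw [algebraMap_eq, totalDegree_C, zero_add]
  refine (totalDegree_finsetProd _ _).trans ?_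
  refine le_trans ?_ (le_totalDegree hd)
  rw [Finsupp.sum]
  refine Finset.sum_le_sum (fun i _ => ?_)
  refine (totalDegree_pow _ _).trans ?_
  have := Nat.mul_le_mul_left (d i) (hg i)
  simpa using this

/-- substitution `x_m := c` -/
def subAt {n : ℕ} (m : Fin n) (c : K) : MvPolynomial (Fin n) K →ₐ[K] MvPolynomial (Fin n) K :=
  aeval (Function.update X m (C c))

def phic {n : ℕ} (c : K) : MvPolynomial (Fin (n+1)) K →ₐ[K] MvPolynomial (Fin n) K :=
  aeval (Fin.cons (C c) X)

def psi {n : ℕ} : MvPolynomial (Fin (n+1)) K →ₐ[K] MvPolynomial (Fin (n+1)) K :=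
  aeval (Fin.cons (C qq * X (Fin.last n)) (fun j => X j.castSucc))

def psi' {n : ℕ} : MvPolynomial (Fin (n+1)) K →ₐ[K] MvPolynomial (Fin (n+1)) K :=
  aeval (Fin.snoc (fun j : Fin n => (X j.succ : MvPolynomial (Fin (n+1)) K)) (C qq⁻¹ * X 0) :
    Fin (n+1) → MvPolynomial (Fin (n+1)) K)

lemma psi'_psi {n : ℕ} (f : MvPolynomial (Fin (n+1)) K) : psi' (psi f) = f := by
  have : (psi'.comp psi : MvPolynomial (Fin (n+1)) K →ₐ[K] _) = AlgHom.id K _ := by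
    apply algHom_ext
    intro i
    refine Fin.cases ?_ (fun i => ?_) i
    · simp only [psi, psi', AlgHom.comp_apply, aeval_X, Fin.cons_zero, map_mul, aeval_C, Fin.snoc_last,
        algebraMap_eq, ← mul_assoc, ← C_mul, mul_inv_cancel₀ qq_ne, AlgHom.id_apply]
      simp
    · simp [psi, psi']
  exact DFunLike.congr_fun this f

lemma sub_psi' {n : ℕ} (m : Fin n) (c : K) (f : MvPolynomial (Fin (n+1)) K) :
    subAt m.succ c (psi' f) = psi' (subAt m.castSucc c f) := by
  have : (subAt m.succ c).comp psi' = psi'.comp (subAt m.castSucc c) := by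
    apply algHom_ext
    intro i
    refine Fin.lastCases ?_ (fun i => ?_) i
    · have h1 : (0 : Fin (n+1)) ≠ m.succ := (Fin.succ_ne_zero m).symm
      have h2 : Fin.last n ≠ m.castSucc := (Fin.castSucc_lt_last m).ne'
      simp [subAt, psi', Function.update_of_ne h1, Function.update_of_ne h2]
    · by_cases h : i = m
      · subst h; simp [subAt, psi']
      · have h1 : i.succ ≠ m.succ := by simpa using h
        have h2 : i.castSucc ≠ m.castSucc := by simpa using h
        simp [subAt, psi', Function.update_of_ne h1, Function.update_of_ne h2]
  exact DFunLike.congr_fun this f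

lemma eval_psi {n : ℕ} (η : Fin (n+1) → ℕ) (f : MvPolynomial (Fin (n+1)) K) :
    eval (evalPt η) (psi f) = eval (evalPt (Phi η)) f := by
  have : (aeval (evalPt η)).comp psi = (aeval (evalPt (Phi η)) : _ →ₐ[K] K) := by
    apply algHom_ext
    intro i
    rw [evalPt_Phi]
    refine Fin.cases ?_ (fun i => ?_) i <;> simp [psi]
  simpa using DFunLike.congr_fun this f

lemma eval_phic {n : ℕ} (ν : Fin n → ℕ) (f : MvPolynomial (Fin (n+1)) K) :
    eval (evalPt ν) (phic (tt ^ (-(n:ℤ))) f) = eval (evalPt (Fin.cons 0 ν : Fin (n+1) → ℕ)) f := by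
  have : (aeval (evalPt ν)).comp (phic (tt ^ (-(n:ℤ)))) =
      (aeval (evalPt (Fin.cons 0 ν : Fin (n+1) → ℕ)) : _ →ₐ[K] K) := by
    apply algHom_ext
    intro i
    rw [evalPt_cons]
    refine Fin.cases ?_ (fun i => ?_) i <;> simp [phic]
  simpa using DFunLike.congr_fun this f

lemma eval_sub' {n : ℕ} (m : Fin n) (x : Fin n → K) (f : MvPolynomial (Fin n) K) :
    eval x (subAt m (x m) f) = eval x f := by
  have : (aeval x).comp (subAt m (x m)) = (aeval x : _ →ₐ[K] K) := by
    apply algHom_ext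
    intro i
    by_cases h : i = m
    · subst h; simp [subAt]
    · simp [subAt, Function.update_of_ne h]
  simpa using DFunLike.congr_fun this f

lemma dvd_of_phic {n : ℕ} (c : K) (f : MvPolynomial (Fin (n+1)) K) (h : phic c f = 0) :
    ∃ g, f = (X 0 - C c) * g := by
  let I : Ideal (MvPolynomial (Fin (n+1)) K) := Ideal.span {X 0 - C c}
  have : ((Ideal.Quotient.mkₐ K I).comp (rename Fin.succ)).comp (phic c) =
      Ideal.Quotient.mkₐ K I := by
    apply algHom_ext
    intro i
    refine Fin.cases ?_ (fun i => ?_) i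
    · simp only [phic, AlgHom.comp_apply, aeval_X, Fin.cons_zero, rename_C]
      symm
      simp only [Ideal.Quotient.mkₐ_eq_mk]
      rw [Ideal.Quotient.eq]
      exact Ideal.mem_span_singleton_self _
    · simp [phic]
  have h2 := DFunLike.congr_fun this f
  simp only [AlgHom.comp_apply, h, map_zero] at h2
  have h3 := h2.symm
  rw [Ideal.Quotient.mkₐ_eq_mk, Ideal.Quotient.eq_zero_iff_mem, Ideal.mem_span_singleton] at h3
  exact h3

lemma lin_ne {n : ℕ} (c : K) (m : Fin n) : (X m - C c : MvPolynomial (Fin n) K) ≠ 0 := by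
  intro h
  have := congrArg (eval (fun _ => c + 1)) h
  simp at this

lemma deg_lin {n : ℕ} (c : K) (m : Fin n) : (X m - C c : MvPolynomial (Fin n) K).totalDegree = 1 := by
  rw [sub_eq_add_neg, ← C_neg, totalDegree_add_eq_left_of_totalDegree_lt] <;> simp

lemma deg_phic {n : ℕ} (c : K) (f : MvPolynomial (Fin (n+1)) K) :
    (phic c f).totalDegree ≤ f.totalDegree := by
  apply totalDegree_aeval_le'
  intro i
  refine Fin.cases ?_ (fun i => ?_) i <;> simp

lemma deg_psi {n : ℕ} (f : MvPolynomial (Fin (n+1)) K) :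
    (psi f).totalDegree ≤ f.totalDegree := by
  apply totalDegree_aeval_le'
  intro i
  refine Fin.cases ?_ (fun i => ?_) i
  · simp only [Fin.cons_zero]
    refine (totalDegree_mul _ _).trans ?_
    simp
  · simp

lemma deg_factor {n : ℕ} (c : K) (m : Fin n) (g : MvPolynomial (Fin n) K) (hg : g ≠ 0) :
    ((X m - C c) * g).totalDegree = g.totalDegree + 1 := by
  rw [totalDegree_mul_of_isDomain (lin_ne c m) hg, deg_lin, add_comm]

lemma eval_g_zero {n : ℕ} (g : MvPolynomial (Fin (n+1)) K) (η : Fin (n+1) → ℕ)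
    (h : eval (evalPt (Phi η)) ((X 0 - C (tt ^ (-(n:ℤ)))) * g) = 0) :
    eval (evalPt η) (psi g) = 0 := by
  rw [eval_psi]
  rw [map_mul, mul_eq_zero] at h
  refine h.resolve_left ?_
  simp only [map_sub, eval_X, eval_C, sub_ne_zero]
  exact qt_ne _ _ _

lemma uniq (n : ℕ) : ∀ (d : ℕ) (f : MvPolynomial (Fin n) K), f.totalDegree ≤ d →
    (∀ ν : Fin n → ℕ, csize ν ≤ d → eval (evalPt ν) f = 0) → f = 0 := by
  induction n with
  | zero =>
    intro d f _ h
    have h0 := h 0 (by simp [csize])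
    rw [eq_C_of_isEmpty f] at h0 ⊢
    rw [eval_C] at h0
    rw [h0, C_0]
  | succ n ih =>
    intro d
    induction d with
    | zero =>
      intro f hd h
      have h0 := h 0 (by simp [csize])
      rw [totalDegree_eq_zero_iff_eq_C.1 (Nat.le_zero.1 hd)] at h0 ⊢
      rw [eval_C] at h0
      rw [h0, C_0]
    | succ d ihd =>
      intro f hd h
      have h1 : phic (tt ^ (-(n:ℤ))) f = 0 := by
        apply ih (d+1) _ ((deg_phic _ _).trans hd)
        intro ν hν
        rw [eval_phic]
        exact h _ (by rwa [csize_cons])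
      obtain ⟨g, rfl⟩ := dvd_of_phic _ _ h1
      by_cases hg : g = 0
      · simp [hg]
      rw [deg_factor _ _ _ hg] at hd
      have : psi g = 0 := by
        apply ihd _ ((deg_psi _).trans (by omega))
        intro η hη
        exact eval_g_zero g η (h _ (by rw [csize_Phi]; omega))
      rw [← psi'_psi g, this, map_zero, mul_zero]

lemma exists_Phi {n : ℕ} (μ : Fin (n+1) → ℕ) (h : μ 0 ≠ 0) : ∃ η, Phi η = μ ∧ 
    ∀ i : Fin n, η i.castSucc = μ i.succ := by
  refine ⟨Fin.snoc (fun j : Fin n => μ j.succ) (μ 0 - 1) , ?_, fun i => by simp⟩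
  funext i
  refine Fin.cases ?_ (fun i => ?_) i
  · simp [Phi]; omega
  · simp [Phi]

lemma sub_zero_of {n : ℕ} (c : K) (g : MvPolynomial (Fin (n+1)) K) :
    subAt 0 c ((X 0 - C c) * g) = 0 := by
  simp [subAt]

lemma vanish {n : ℕ} (k : ℕ) : k ≤ n + 1 → ∀ (μ : Fin (n+1) → ℕ) (f : MvPolynomial (Fin (n+1)) K),
    (∀ i : Fin (n+1), (i:ℕ) < k → μ i ≠ 0) → f.totalDegree ≤ csize μ →
    (∀ ν, csize ν ≤ csize μ → ν ≠ μ → eval (evalPt ν) f = 0) →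
    ∀ m : Fin (n+1), (m:ℕ) < k → subAt m (tt ^ (-(n:ℤ))) f = 0 := by
  induction k with
  | zero => intro _ _ _ _ _ _ m hm; omega
  | succ k ih =>
    intro hkn μ f hμ hd h
    have hμ0 : μ 0 ≠ 0 := hμ 0 (by simp)
    have h1 : phic (tt ^ (-(n:ℤ))) f = 0 := by
      apply uniq n (csize μ) _ ((deg_phic _ _).trans hd)
      intro ν hν
      rw [eval_phic]
      refine h _ (by rwa [csize_cons]) ?_
      rintro rfl
      simp at hμ0
    obtain ⟨g, rfl⟩ := dvd_of_phic _ _ h1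
    by_cases hg : g = 0
    · simp [hg]
    rw [deg_factor _ _ _ hg] at hd
    obtain ⟨η, rfl, hη⟩ := exists_Phi μ hμ0
    rw [csize_Phi] at hd
    intro m hm
    induction m using Fin.cases with
    | zero => exact sub_zero_of _ _
    | succ m =>
      have hm' : (m:ℕ) < k := by simpa using hm
      have key := ih (by omega) η (psi g) ?_ ((deg_psi g).trans (by omega)) ?_ m.castSucc (by simpa using hm')
      · rw [map_mul, ← psi'_psi g, sub_psi', key, map_zero, mul_zero]
      · intro i hi
        have : (i:ℕ) < n := by omega
        have h2 := hη ⟨i, this⟩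
        have h3 : (⟨i, this⟩ : Fin n).castSucc = i := rfl
        rw [h3] at h2
        rw [h2]
        exact hμ _ (by simpa using hi)
      · intro ν hν hne
        apply eval_g_zero
        apply h _ (by rw [csize_Phi, csize_Phi]; omega)
        intro he
        apply hne
        funext i
        refine Fin.lastCases ?_ (fun i => ?_) i
        · have := congrFun he 0
          simpa [Phi] using this
        · have := congrFun he i.succ
          simpa [Phi] using this

lemma swap_subAt {n : ℕ} (i j m : Fin n) (c : K) (f : MvPolynomial (Fin n) K) :
    subAt m c (swapVars i j f) = swapVars i j (subAt (Equiv.swap i j m) c f) := by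
  have : (subAt m c).comp (rename (Equiv.swap i j)) =
      (rename (Equiv.swap i j)).comp (subAt (Equiv.swap i j m) c) := by
    apply algHom_ext
    intro a
    by_cases h : a = Equiv.swap i j m
    · subst h; simp [subAt]
    · have h1 : Equiv.swap i j a ≠ m := by
        rintro rfl
        simp at h
      simp [subAt, Function.update_of_ne h, Function.update_of_ne h1]
  exact DFunLike.congr_fun this f

lemma subAt_diff {n : ℕ} (i j m : Fin n) (hij : i ≠ j) (c : K) :
    subAt m c (X i - X j) ≠ 0 := by
  intro h
  have h' := congrArg (eval (fun a => if a = m then c else if a = i then c + 1 else if a = j then c - 1 else 0)) h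
  have h2 : ∀ a : Fin n, eval (fun a => if a = m then c else if a = i then c + 1 else if a = j then c - 1 else 0)
    (Function.update X m (C c) a : MvPolynomial (Fin n) K) = if a = m then c else if a = i then c + 1 else if a = j then c - 1 else 0 := by
    intro a
    by_cases h : a = m
    · subst h; simp
    · simp [Function.update_of_ne h]
  simp only [subAt, map_sub, aeval_X, h2, map_zero] at h'
  by_cases h3 : i = m
  · subst h3
    simp [hij.symm] at h'
  · by_cases h4 : j = m
    · subst h4; simp [h3] at h'
    · simp only [if_neg h3, if_neg h4, if_neg hij.symm, if_true] at h'
      have : (2:K) = 0 := by linear_combination h'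
      norm_num at this

lemma hecke_subAt {n k : ℕ} (i j : Fin n) (hij : i ≠ j) (hi : (i:ℕ) < k) (hj : (j:ℕ) < k) (c : K)
    (f : MvPolynomial (Fin n) K) (hf : ∀ m : Fin n, (m:ℕ) < k → subAt m c f = 0) :
    ∀ m : Fin n, (m:ℕ) < k → subAt m c (hecke i j f) = 0 := by
  intro m hm
  have hs : subAt m c (swapVars i j f) = 0 := by
    rw [swap_subAt, hf, swapVars, map_zero]
    rw [Equiv.swap_apply_def]
    split_ifs <;> assumption
  have hG : subAt m c (exactDiv (f - swapVars i j f) (X i - X j)) = 0 := by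
    unfold exactDiv
    split_ifs with h
    · have h1 := congrArg (subAt m c) h.choose_spec
      rw [map_sub, hf m hm, hs, sub_zero, map_mul] at h1
      exact (mul_eq_zero.1 h1.symm).resolve_left (subAt_diff i j m hij c)
    · exact map_zero _
  unfold hecke
  rw [map_sub, map_mul, map_mul, hf m hm, hG, mul_zero, mul_zero, sub_zero]

lemma Tword_subAt {n k : ℕ} (w : List {i : ℕ // i + 1 < n}) (hw : ∀ i ∈ w, i.1 + 1 < k) (c : K)
    (f : MvPolynomial (Fin n) K) (hf : ∀ m : Fin n, (m:ℕ) < k → subAt m c f = 0) :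
    ∀ m : Fin n, (m:ℕ) < k → subAt m c (Tword w f) = 0 := by
  induction w with
  | nil => exact hf
  | cons a w ih =>
    have h1 := hw a (by simp)
    have := ih (fun i hi => hw i (by simp [hi]))
    refine hecke_subAt _ _ ?_ ?_ ?_ c (Tword w f) this
    · simp [Fin.ext_iff]
    · simp; omega
    · simpa using h1

/-- inversion set -/
def invs {n : ℕ} (σ : Equiv.Perm (Fin n)) : Set (Fin n × Fin n) :=
  {p : Fin n × Fin n | p.1 < p.2 ∧ σ p.2 < σ p.1}

lemma permLength_eq {n : ℕ} (σ : Equiv.Perm (Fin n)) : permLength σ = (invs σ).ncard := rfl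

lemma adj_lt {n : ℕ} (i : {i : ℕ // i + 1 < n}) (u v : Fin n) (h : u < v)
    (h' : ¬ ((u:ℕ) = i.1 ∧ (v:ℕ) = i.1 + 1)) : adjSwap i u < adjSwap i v := by
  unfold adjSwap
  rw [Equiv.swap_apply_def, Equiv.swap_apply_def]
  rw [Fin.lt_def] at *
  simp only [Fin.ext_iff]
  split_ifs <;> simp_all <;> omega

lemma adj_adj {n : ℕ} (i : {i : ℕ // i + 1 < n}) (u : Fin n) : adjSwap i (adjSwap i u) = u := by
  simp [adjSwap]

/-- effect of a left multiplication by `s_i` on inversions -/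
lemma invs_step {n : ℕ} (i : {i : ℕ // i + 1 < n}) (σ : Equiv.Perm (Fin n)) :
    ∃ a b : Fin n, (σ a : ℕ) = i.1 ∧ (σ b : ℕ) = i.1 + 1 ∧
      invs (adjSwap i * σ) ⊆ insert (a, b) (invs σ) ∧
      (b < a → invs (adjSwap i * σ) ⊆ invs σ) ∧
      (a < b → insert (a, b) (invs σ) ⊆ invs (adjSwap i * σ)) := by
  have ha : (σ (σ.symm ⟨i.1, Nat.lt_of_succ_lt i.2⟩) : ℕ) = i.1 := by simp
  have hb : (σ (σ.symm ⟨i.1 + 1, i.2⟩) : ℕ) = i.1 + 1 := by simp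
  generalize σ.symm ⟨i.1, Nat.lt_of_succ_lt i.2⟩ = a at ha
  generalize σ.symm ⟨i.1 + 1, i.2⟩ = b at hb
  have h1 : invs (adjSwap i * σ) ⊆ insert (a, b) (invs σ) := by
    rintro ⟨x, y⟩ ⟨hxy, h⟩
    simp only [Equiv.Perm.mul_apply] at hxy h
    by_cases hc : (σ x : ℕ) = i.1 ∧ (σ y : ℕ) = i.1 + 1
    · left
      have e1 : x = a := σ.injective (Fin.ext (hc.1.trans ha.symm))
      have e2 : y = b := σ.injective (Fin.ext (hc.2.trans hb.symm))
      rw [e1, e2]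
    · right
      refine ⟨hxy, ?_⟩
      rcases lt_trichotomy (σ x) (σ y) with h2 | h2 | h2
      · exact absurd (adj_lt i _ _ h2 hc) h.not_gt
      · rw [h2] at h; exact absurd h (lt_irrefl _)
      · exact h2
  refine ⟨a, b, ha, hb, h1, ?_, ?_⟩
  · intro hba p hp
    rcases h1 hp with h2 | h2
    · subst h2
      exact absurd hp.1 hba.not_gt
    · exact h2
  · intro hab p hp
    rcases hp with rfl | hp
    · refine ⟨hab, ?_⟩
      have e1 : σ a = ⟨i.1, Nat.lt_of_succ_lt i.2⟩ := Fin.ext ha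
      have e2 : σ b = ⟨i.1 + 1, i.2⟩ := Fin.ext hb
      simp [e1, e2, adjSwap, Fin.lt_def]
    · refine ⟨hp.1, ?_⟩
      simp only [Equiv.Perm.mul_apply]
      apply adj_lt i _ _ hp.2
      rintro ⟨h2, h3⟩
      have e1 : p.2 = a := σ.injective (Fin.ext (h2.trans ha.symm))
      have e2 : p.1 = b := σ.injective (Fin.ext (h3.trans hb.symm))
      have := hp.1
      rw [e1, e2] at this
      exact absurd this hab.not_gt

lemma len_step {n : ℕ} (i : {i : ℕ // i + 1 < n}) (σ : Equiv.Perm (Fin n)) :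
    permLength (adjSwap i * σ) ≤ permLength σ + 1 := by
  obtain ⟨a, b, -, -, h, -, -⟩ := invs_step i σ
  rw [permLength_eq, permLength_eq]
  exact (Set.ncard_le_ncard h (Set.toFinite _)).trans (Set.ncard_insert_le _ _)

lemma len_word {n : ℕ} (w : List {i : ℕ // i + 1 < n}) :
    permLength (w.map adjSwap).prod ≤ w.length := by
  induction w with
  | nil =>
    have : invs (1 : Equiv.Perm (Fin n)) = ∅ := by
      ext p
      simp only [invs, Set.mem_ofPred_eq, Equiv.Perm.one_apply, Set.mem_empty_iff_false, iff_false]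
      rintro ⟨h1, h2⟩
      exact absurd h1 h2.not_gt
    simp [permLength_eq, this]
  | cons a w ih =>
    simp only [List.map_cons, List.prod_cons, List.length_cons]
    exact (len_step _ _).trans (by omega)

lemma strict_ge {n : ℕ} (σ : Equiv.Perm (Fin n)) (r : Fin n) (h : ∀ x < r, σ x < σ r) :
    r ≤ σ r := by
  have : (Finset.Iio r).card ≤ (Finset.Iio (σ r)).card :=
    Finset.card_le_card_of_injOn σ (by
      intro x hx
      rw [Finset.mem_coe, Finset.mem_Iio] at hx ⊢
      exact h x hx) (σ.injective.injOn)
  rw [Fin.card_Iio, Fin.card_Iio] at this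
  exact Fin.le_def.2 this

lemma fix_of_invs {n k : ℕ} (σ : Equiv.Perm (Fin n)) (h : ∀ p ∈ invs σ, (p.2 : ℕ) < k)
    (b : Fin n) (hb : (b:ℕ) < k) : (σ b : ℕ) < k := by
  -- the points `≥ k` weakly move up, hence `σ⁻¹` ... count
  have hge : ∀ r : Fin n, k ≤ (r:ℕ) → r ≤ σ r := by
    intro r hr
    apply strict_ge
    intro x hx
    by_contra hc
    have hne : σ x ≠ σ r := fun e => hx.ne (σ.injective e)
    have := h (x, r) ⟨hx, lt_of_le_of_ne (not_lt.1 hc) hne.symm⟩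
    simp at this
    omega
  by_contra hc
  -- injection of {≥ k} ∪ {b} into {≥ k}
  let S : Finset (Fin n) := Finset.univ.filter (fun r : Fin n => k ≤ (r:ℕ))
  have hbS : b ∉ S := by simp [S]; omega
  have : (insert b S).card ≤ S.card := by
    apply Finset.card_le_card_of_injOn σ _ σ.injective.injOn
    intro x hx
    simp only [Finset.coe_insert, Set.mem_insert_iff, Finset.mem_coe] at hx
    simp only [S, Finset.coe_filter, Finset.mem_univ, true_and, Set.mem_ofPred_eq]
    rcases hx with rfl | hx
    · omega
    · have h1 : k ≤ (x:ℕ) := by simpa [S] using hx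
      have := hge x h1
      rw [Fin.le_def] at this
      omega
  rw [Finset.card_insert_of_notMem hbS] at this
  omega

lemma word_small {n k : ℕ} (w : List {i : ℕ // i + 1 < n}) :
    w.length = permLength (w.map adjSwap).prod →
    (∀ p ∈ invs (w.map adjSwap).prod, (p.2 : ℕ) < k) → ∀ i ∈ w, i.1 + 1 < k := by
  induction w with
  | nil => intro _ _ i hi; simp at hi
  | cons i w ih =>
    simp only [List.map_cons, List.prod_cons, List.length_cons]
    intro hl h
    have hw := len_word w
    generalize (w.map adjSwap).prod = σ at *
    have h1 := len_step i σ
    obtain ⟨a, b, ha, hb, -, h2, h3⟩ := invs_step i σ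
    have hab : a < b := by
      rcases lt_trichotomy a b with h4 | h4 | h4
      · exact h4
      · rw [h4, hb] at ha; omega
      · have := Set.ncard_le_ncard (h2 h4) (Set.toFinite _)
        rw [← permLength_eq, ← permLength_eq] at this
        omega
    have h3 := h3 hab
    have hσ : ∀ p ∈ invs σ, (p.2 : ℕ) < k := fun p hp => h p (h3 (Or.inr hp))
    have hbk : (b:ℕ) < k := h (a, b) (h3 (Or.inl rfl))
    have := fix_of_invs σ hσ b hbk
    intro j hj
    rcases List.mem_cons.1 hj with rfl | hj
    · omega
    · exact ih (by omega) hσ j hj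

lemma sigmaMin_invs {n k : ℕ} (l μ : Fin n → ℕ) (hl : Packed k l) (hμ : Packed k μ) :
    ∀ p ∈ invs (sigmaMin l μ), (p.2 : ℕ) < k := by
  unfold sigmaMin
  split_ifs with h
  · obtain ⟨h1, h2⟩ := h.choose_spec
    generalize h.choose = σ at h1 h2
    have hlσ : ∀ x, l x = μ (σ x) := by
      intro x
      rw [← h1]; simp [permAct]
    have hk : ∀ x : Fin n, (x:ℕ) < k ↔ (σ x : ℕ) < k := by
      intro x
      have e := hlσ x
      constructor
      · intro hx
        by_contra hc
        exact (hl x).1 hx (e.trans ((hμ (σ x)).2 (not_lt.1 hc)))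
      · intro hx
        by_contra hc
        exact (hμ (σ x)).1 hx (e.symm.trans ((hl x).2 (not_lt.1 hc)))
    let τ : Equiv.Perm (Fin n) := Equiv.Perm.ofSubtype
      (Equiv.Perm.subtypePerm σ (p := fun x : Fin n => (x:ℕ) < k) (fun x => (hk x).symm))
    have t1 : ∀ x : Fin n, (x:ℕ) < k → τ x = σ x := by
      intro x hx
      simp only [τ]
      rw [Equiv.Perm.ofSubtype_apply_of_mem (p := fun x : Fin n => (x:ℕ) < k) _ hx]
      rfl
    have t2 : ∀ x : Fin n, ¬ (x:ℕ) < k → τ x = x := by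
      intro x hx
      exact Equiv.Perm.ofSubtype_apply_of_not_mem _ hx
    have hτ : permAct τ l = μ := by
      funext y
      obtain ⟨x, rfl⟩ := τ.surjective y
      simp only [permAct, Function.comp, Equiv.symm_apply_apply]
      by_cases hx : (x:ℕ) < k
      · rw [t1 x hx, hlσ]
      · rw [t2 x hx, (hl x).2 (not_lt.1 hx), (hμ x).2 (not_lt.1 hx)]
    have hinv : ∀ p ∈ invs τ, (p.2:ℕ) < k := by
      rintro ⟨x, y⟩ ⟨hxy, h3⟩
      simp only at hxy h3 ⊢
      by_contra hc
      rw [t2 y hc] at h3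
      by_cases hx : (x:ℕ) < k
      · have := (hk x).1 hx
        rw [t1 x hx, Fin.lt_def] at h3
        omega
      · rw [t2 x hx] at h3
        exact absurd hxy h3.not_gt
    have hsub : invs τ ⊆ invs σ := by
      rintro ⟨x, y⟩ hp
      have hy : (y:ℕ) < k := hinv _ hp
      obtain ⟨hxy, h3⟩ := hp
      simp only at hxy h3
      have hx : (x:ℕ) < k := by rw [Fin.lt_def] at hxy; omega
      rw [t1 x hx, t1 y hy] at h3
      exact ⟨hxy, h3⟩
    have := Set.eq_of_subset_of_ncard_le hsub (h2 τ hτ) (Set.toFinite _)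
    rw [← this]
    exact hinv
  · rintro ⟨x, y⟩ ⟨h1, h2⟩
    exact absurd h1 h2.not_gt

lemma packed_sort {n k : ℕ} (hkn : k ≤ n) (μ : Fin n → ℕ) (hμ : Packed k μ) : Packed k (sortDesc μ) := by
  unfold sortDesc
  split_ifs with h
  · obtain ⟨hp, σ, hσ⟩ := h.choose_spec
    generalize h.choose = l at hp hσ
    have hlσ : ∀ x, l x = μ (σ x) := by
      intro x
      rw [← hσ]; simp [permAct]
    have hμ' : ∀ x : Fin n, μ x ≠ 0 ↔ (x:ℕ) < k := fun x =>
      ⟨fun h => by by_contra hc; exact h ((hμ x).2 (not_lt.1 hc)), (hμ x).1⟩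
    have hcard : (Finset.univ.filter (fun x : Fin n => l x ≠ 0)).card = k := by
      have e1 : (Finset.univ.filter (fun x : Fin n => l x ≠ 0)).card =
          (Finset.univ.filter (fun x : Fin n => (x:ℕ) < k)).card := by
        apply Finset.card_bij (fun x _ => σ x)
        · intro x hx
          simp only [Finset.mem_filter, Finset.mem_univ, true_and] at hx ⊢
          rw [← hμ', ← hlσ]; exact hx
        · intro x _ y _ e; exact σ.injective e
        · intro y hy
          simp only [Finset.mem_filter, Finset.mem_univ, true_and] at hy
          refine ⟨σ.symm y, ?_, by simp⟩
          simp only [Finset.mem_filter, Finset.mem_univ, true_and]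
          rw [hlσ]; simpa using (hμ' y).2 hy
      rw [e1, Fin.card_filter_val_lt]
      omega
    intro i
    constructor
    · intro hi h0
      have : Finset.univ.filter (fun x : Fin n => l x ≠ 0) ⊆ Finset.Iio i := by
        intro x hx
        simp only [Finset.mem_filter, Finset.mem_univ, true_and, Finset.mem_Iio] at hx ⊢
        by_contra hc
        have := hp i x (not_lt.1 hc)
        omega
      have := Finset.card_le_card this
      rw [hcard, Fin.card_Iio] at this
      omega
    · intro hi
      by_contra h0
      have : Finset.Iic i ⊆ Finset.univ.filter (fun x : Fin n => l x ≠ 0) := by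
        intro x hx
        simp only [Finset.mem_filter, Finset.mem_univ, true_and, Finset.mem_Iic] at hx ⊢
        have := hp x i hx
        omega
      have := Finset.card_le_card this
      rw [hcard, Fin.card_Iic] at this
      omega
  · exact hμ

lemma Estar_subAt {n k : ℕ} (hkn : k ≤ n + 1) (μ : Fin (n+1) → ℕ) (hμ : Packed k μ) :
    ∀ m : Fin (n+1), (m:ℕ) < k → subAt m (tt ^ (-(n:ℤ))) (Estar μ) = 0 := by
  unfold Estar
  split_ifs with h
  · obtain ⟨h1, -, h2⟩ := h.choose_spec
    exact vanish k hkn μ _ (fun i => (hμ i).1) h1 h2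
  · intro m _; exact map_zero _

lemma fstar_subAt {n k : ℕ} (hkn : k ≤ n + 1) (μ : Fin (n+1) → ℕ) (hμ : Packed k μ) :
    ∀ m : Fin (n+1), (m:ℕ) < k → subAt m (tt ^ (-(n:ℤ))) (fstar μ) = 0 := by
  have hl := packed_sort hkn μ hμ
  have hE := Estar_subAt hkn _ hl
  have hi := sigmaMin_invs _ μ hl hμ
  unfold fstar Tsigma
  split_ifs with h
  · obtain ⟨h1, h2⟩ := h.choose_spec
    refine Tword_subAt _ ?_ _ _ hE
    apply word_small
    · rw [h1]; exact h2
    · rw [h1]; exact hi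
  · exact hE

lemma eval_zero_of_subAt {n k : ℕ} (f : MvPolynomial (Fin (n+1)) K)
    (hf : ∀ m : Fin (n+1), (m:ℕ) < k → subAt m (tt ^ (-(n:ℤ))) f = 0) (ν : Fin (n+1) → ℕ)
    (i0 : Fin (n+1)) (hi0 : (i0 : ℕ) < k) (hν : ν i0 = 0) : eval (evalPt ν) f = 0 := by
  obtain ⟨i, hi, hmin⟩ := WellFounded.has_min (wellFounded_lt (α := Fin (n+1))) {i | ν i = 0} ⟨i0, hν⟩
  have h1 : evalPt ν i = tt ^ (-(n:ℤ)) := by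
    have hi' : ν i = 0 := hi
    rw [evalPt, kstat_first ν i hi' (fun j hj h0 => hmin j h0 hj), hi', pow_zero, one_mul]
  have h2 : i ≤ i0 := not_lt.1 (hmin i0 hν)
  rw [← eval_sub' i, h1, hf i (by rw [Fin.le_def] at h2; omega), map_zero]

/-- extra vanishing for packed compositions. -/
theorem statement10 (n k : ℕ) (hk1 : 1 ≤ k) (hkn : k ≤ n)
    (μ : Fin n → ℕ) (hμ : Packed k μ) (ν : Fin n → ℕ)
    (i0 : Fin n) (hi0 : (i0 : ℕ) < k) (hν : ν i0 = 0) :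
    ¬ Precedes μ ν ∧ eval (evalPt ν) (Estar μ) = 0 ∧ eval (evalPt ν) (fstar μ) = 0 := by
  refine ⟨?_, ?_⟩
  · rintro ⟨π, h1, h2⟩
    have h3 := h1 (π.symm i0)
    have h4 := h2 (π.symm i0)
    rw [Equiv.apply_symm_apply, hν] at h3 h4
    have h5 : μ (π.symm i0) = 0 := Nat.le_zero.1 h3
    have h6 : k ≤ ((π.symm i0 : Fin n) : ℕ) := by
      by_contra hc
      exact (hμ _).1 (not_le.1 hc) h5
    have := h4 (by rw [Fin.lt_def]; omega)
    omega
  · obtain ⟨n, rfl⟩ : ∃ m, n = m + 1 := ⟨n - 1, by omega⟩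
    exact ⟨eval_zero_of_subAt _ (Estar_subAt hkn μ hμ) ν i0 hi0 hν,
      eval_zero_of_subAt _ (fstar_subAt hkn μ hμ) ν i0 hi0 hν⟩
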